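/- arXiv:1508.03664 — 3 statements merged into one kernel-verified Lean document; each statement's English description precedes it below -/
import Mathlib

section
/- For every integer N ≥ K, the difference between the feedback-aided and unaided intercept probabilities satisfies P^FT_int(N) − P^UT_int(N) = −∑_{n_T=K+1}^{N} f_E(n_T) · F_B(n_T − 1). -/
open Finset

/-- Decoding probability P(n_R, K) = ∏_{i=0}^{K−1} (1 − q^{−(n_R − i)}). -/
noncomputable def Pdec (q K nR : ℕ) : ℝ :=
  ∏ i ∈ Finset.range K, (1 - (q : ℝ) ^ (-((nR : ℤ) - (i : ℤ))))

/-- CDF F_ε(n_T) = ∑_{n_R=K}^{n_T} C(n_T,n_R) (1−ε)^{n_R} ε^{n_T−n_R} P(n_R,K). -/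
noncomputable def Fcdf (q K : ℕ) (ε : ℝ) (nT : ℕ) : ℝ :=
  ∑ nR ∈ Finset.Icc K nT,
    (nT.choose nR : ℝ) * (1 - ε) ^ nR * ε ^ (nT - nR) * Pdec q K nR

/-- PMF f_ε(n_T) = F_ε(n_T) − F_ε(n_T−1) for n_T > K, and f_ε(K) = F_ε(K). -/
noncomputable def fpmf (q K : ℕ) (ε : ℝ) (nT : ℕ) : ℝ :=
  if nT = K then Fcdf q K ε K else Fcdf q K ε nT - Fcdf q K ε (nT - 1)

/-- Intercept probability of feedback-aided transmission. -/
noncomputable def PFT (q K : ℕ) (εB εE : ℝ) (N : ℕ) : ℝ :=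
  (∑ nT ∈ Finset.Icc K N, fpmf q K εB nT * Fcdf q K εE nT)
    + Fcdf q K εE N * (1 - Fcdf q K εB N)

/-- Intercept probability of unaided transmission. -/
noncomputable def PUT (q K : ℕ) (εE : ℝ) (N : ℕ) : ℝ := Fcdf q K εE N

theorem ft_minus_ut (q K : ℕ) (hq : 2 ≤ q) (hK : 1 ≤ K)
    (εB εE : ℝ) (hεB : εB ∈ Set.Icc (0:ℝ) 1) (hεE : εE ∈ Set.Icc (0:ℝ) 1)
    (N : ℕ) (hN : K ≤ N) :
    PFT q K εB εE N - PUT q K εE N =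
      - ∑ nT ∈ Finset.Icc (K + 1) N, fpmf q K εE nT * Fcdf q K εB (nT - 1) := by
  induction N, hN using Nat.le_induction with
  | base => simp [PFT, PUT, fpmf]; ring
  | succ n hn ih =>
    have hne : n + 1 ≠ K := by omega
    simp only [PFT, PUT] at ih ⊢
    rw [Finset.sum_Icc_succ_top (by omega), Finset.sum_Icc_succ_top (by omega)]
    simp only [fpmf, hne, if_false, Nat.add_sub_cancel] at ih ⊢
    linear_combination ih
end

section
/- (Proposition 1, unaided transmission.) The unaided intercept probability is a nondecreasing function of the number of transmitted coded packets: for every erasure probability ε ∈ [0,1] and all integers K ≤ N₁ ≤ N₂, F_ε(N₁) ≤ F_ε(N₂). In particular P^UT_int(N₁) ≤ P^UT_int(N₂). -/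
open Finset

theorem Pdec_eq_zero_of_lt {q K n : ℕ} (h : n < K) : Pdec q K n = 0 :=
  Finset.prod_eq_zero (Finset.mem_range.mpr h) (by simp)

theorem Pdec_factor_nonneg {q K n i : ℕ} (hq : 1 ≤ q) (h : K ≤ n) (hi : i ∈ Finset.range K) :
    0 ≤ 1 - (q : ℝ) ^ (-((n : ℤ) - (i : ℤ))) := by
  have hi := Finset.mem_range.mp hi
  exact sub_nonneg.mpr (zpow_le_one_of_nonpos₀ (by exact_mod_cast hq) (by omega))

theorem Pdec_nonneg {q : ℕ} (K n : ℕ) (hq : 1 ≤ q) : 0 ≤ Pdec q K n := by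
  rcases lt_or_ge n K with h | h
  · exact (Pdec_eq_zero_of_lt h).ge
  · exact Finset.prod_nonneg fun i hi => Pdec_factor_nonneg hq h hi

theorem Pdec_monotone {q : ℕ} (K : ℕ) (hq : 1 ≤ q) : Monotone (Pdec q K) := by
  intro m n hmn
  rcases lt_or_ge m K with h | h
  · exact (Pdec_eq_zero_of_lt h).trans_le (Pdec_nonneg K n hq)
  · refine Finset.prod_le_prod (fun i hi => Pdec_factor_nonneg hq h hi) fun i _ => ?_
    exact sub_le_sub_left (zpow_le_zpow_right₀ (by exact_mod_cast hq) (by omega)) 1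

theorem Fcdf_eq_sum_antidiagonal (q K : ℕ) (ε : ℝ) (n : ℕ) :
    Fcdf q K ε n = ∑ ij ∈ Finset.HasAntidiagonal.antidiagonal n,
      (n.choose ij.1 : ℝ) * ((1 - ε) ^ ij.1 * ε ^ ij.2 * Pdec q K ij.1) := by
  rw [Finset.Nat.sum_antidiagonal_eq_sum_range_succ
    (fun i j => (n.choose i : ℝ) * ((1 - ε) ^ i * ε ^ j * Pdec q K i)), Fcdf]
  simp only [mul_assoc]
  refine Finset.sum_subset (fun r hr => ?_) fun r hr hr' => ?_
  · simp only [Finset.mem_Icc, Finset.mem_range] at *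
    omega
  · rw [Pdec_eq_zero_of_lt (n := r)]
    · simp
    · simp only [Finset.mem_Icc, Finset.mem_range] at *
      omega

theorem Fcdf_monotone {q : ℕ} (K : ℕ) (hq : 1 ≤ q) {ε : ℝ} (hε : ε ∈ Set.Icc (0 : ℝ) 1) :
    Monotone (Fcdf q K ε) := by
  refine monotone_nat_of_le_succ fun n => ?_
  obtain ⟨h0, h1⟩ := hε
  have h1 := sub_nonneg.mpr h1
  rw [Fcdf_eq_sum_antidiagonal, Fcdf_eq_sum_antidiagonal,
    Finset.sum_antidiagonal_choose_succ_mul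
      (fun i j => (1 - ε) ^ i * ε ^ j * Pdec q K i), ← Finset.sum_add_distrib]
  refine Finset.sum_le_sum fun ij hij => ?_
  rw [← Nat.choose_symm_of_eq_add (Finset.HasAntidiagonal.mem_antidiagonal.mp hij).symm]
  have hP : Pdec q K ij.1 ≤ Pdec q K (ij.1 + 1) := Pdec_monotone K hq (Nat.le_succ _)
  calc (n.choose ij.1 : ℝ) * ((1 - ε) ^ ij.1 * ε ^ ij.2 * Pdec q K ij.1)
      = n.choose ij.1 * ((1 - ε) ^ ij.1 * ε ^ (ij.2 + 1) * Pdec q K ij.1) +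
        n.choose ij.1 * ((1 - ε) ^ (ij.1 + 1) * ε ^ ij.2 * Pdec q K ij.1) := by ring
    _ ≤ _ := by gcongr

theorem ut_intercept_monotone (q K : ℕ) (hq : 2 ≤ q) (hK : 1 ≤ K)
    (ε : ℝ) (hε : ε ∈ Set.Icc (0:ℝ) 1) (N₁ N₂ : ℕ) (hN₁ : K ≤ N₁) (h12 : N₁ ≤ N₂) :
    Fcdf q K ε N₁ ≤ Fcdf q K ε N₂ ∧ PUT q K ε N₁ ≤ PUT q K ε N₂ := by
  have h := Fcdf_monotone K (one_le_two.trans hq) hε h12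
  exact ⟨h, h⟩
end

section
/- (Appendix B difference formula.) For all integers K ≤ N₁ ≤ N₂, the feedback-aided intercept probability satisfies P^FT_int(N₂) − P^FT_int(N₁) = ∑_{n_T=N₁+1}^{N₂} f_E(n_T) · (1 − F_B(n_T − 1)). -/
open Finset

theorem fpmf_succ {q K n : ℕ} (ε : ℝ) (h : K ≤ n) :
    fpmf q K ε (n + 1) = Fcdf q K ε (n + 1) - Fcdf q K ε n := by
  rw [fpmf, if_neg (by lia), Nat.add_sub_cancel]

theorem PFT_succ_sub {q K n : ℕ} (εB εE : ℝ) (h : K ≤ n) :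
    PFT q K εB εE (n + 1) - PFT q K εB εE n =
      fpmf q K εE (n + 1) * (1 - Fcdf q K εB n) := by
  rw [PFT, PFT, Finset.sum_Icc_succ_top (by lia), fpmf_succ εB h, fpmf_succ εE h]
  ring

theorem ft_intercept_difference (q K : ℕ) (hq : 2 ≤ q) (hK : 1 ≤ K)
    (εB εE : ℝ) (hεB : εB ∈ Set.Icc (0:ℝ) 1) (hεE : εE ∈ Set.Icc (0:ℝ) 1)
    (N₁ N₂ : ℕ) (hN₁ : K ≤ N₁) (h12 : N₁ ≤ N₂) :
    PFT q K εB εE N₂ - PFT q K εB εE N₁ =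
      ∑ nT ∈ Finset.Icc (N₁ + 1) N₂,
        fpmf q K εE nT * (1 - Fcdf q K εB (nT - 1)) := by
  induction N₂, h12 using Nat.le_induction with
  | base => simp
  | succ n hn ih =>
    rw [Finset.sum_Icc_succ_top (by lia), ← ih, Nat.add_sub_cancel,
      ← PFT_succ_sub εB εE (hN₁.trans hn)]
    ring
end
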